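/- There exists a universal constant c > 0 such that for all t, s ∈ ℝ and all ρ ∈ (0,1], ∫_0^ρ h_r(t,s) dr ≥ (c/4) · ρ / ((1 + |t|)(1 + |s|)), where h_r(t,s) = (1 − r²)^{−1/2} · exp( (r t s − ½(t² + s²) r²) / (1 − r²) ). -/

import Mathlib

/-- The kernel `h_r(t,s) = (1-r²)^{-1/2} exp((rts - ½(t²+s²)r²)/(1-r²))`. -/
noncomputable def hker (r t s : ℝ) : ℝ :=
  (1 / Real.sqrt (1 - r ^ 2)) *
    Real.exp ((r * t * s - (t ^ 2 + s ^ 2) / 2 * r ^ 2) / (1 - r ^ 2))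


lemma hker_nonneg (r t s : ℝ) : 0 ≤ hker r t s := by
  unfold hker; positivity

lemma hker_intervalIntegrable_one (t s : ℝ) :
    IntervalIntegrable (fun r => hker r t s) MeasureTheory.volume 0 1 := by
  have h1 : IntervalIntegrable (fun r : ℝ => 1 / Real.sqrt (1 - r ^ 2))
      MeasureTheory.volume 0 1 := by
    apply intervalIntegral.intervalIntegrable_deriv_of_nonneg (g := Real.arcsin)
    · exact Real.continuous_arcsin.continuousOn
    · intro x hx
      simp only [zero_le_one, min_eq_left, max_eq_right, Set.mem_Ioo] at hx
      exact Real.hasDerivAt_arcsin (by linarith) (by linarith)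
    · intro x _
      positivity
  have h2 := h1.mul_const (Real.exp (|t * s|))
  refine h2.mono_fun' ?_ ?_
  · apply Measurable.aestronglyMeasurable
    unfold hker
    fun_prop
  · rw [Set.uIoc_of_le zero_le_one]
    filter_upwards [MeasureTheory.ae_restrict_mem measurableSet_Ioc] with r hr
    rw [Real.norm_of_nonneg (hker_nonneg r t s)]
    unfold hker
    obtain ⟨h0, h1⟩ := hr
    rcases h1.eq_or_lt with rfl | h1
    · simp
    have hpos : 0 < 1 - r ^ 2 := by nlinarith
    gcongr
    rw [div_le_iff₀ hpos]
    have ha : |t| * |s| = |t * s| := (abs_mul t s).symm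
    have hb : |t * s| ≤ (t ^ 2 + s ^ 2) / 2 := by
      rw [← ha]; nlinarith [sq_nonneg (|t| - |s|), sq_abs t, sq_abs s]
    have hc := le_abs_self (t * s)
    have hd := abs_nonneg (t * s)
    have he : r * t * s ≤ r * |t * s| := by nlinarith
    have hf : |t * s| * r ^ 2 ≤ (t ^ 2 + s ^ 2) / 2 * r ^ 2 := by gcongr
    nlinarith

/-- Uniform lower bound on `∫₀^ρ h_r(t,s) dr`. -/
theorem stmt8 :
    ∃ c : ℝ, 0 < c ∧ ∀ t s ρ : ℝ, 0 < ρ → ρ ≤ 1 →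
      (∫ r in (0 : ℝ)..ρ, hker r t s) ≥ c / 4 * ρ / ((1 + |t|) * (1 + |s|)) := by
  refine ⟨2 * Real.exp (-1), by positivity, ?_⟩
  intro t s ρ hρ hρ1
  have ht := abs_nonneg t
  have hs := abs_nonneg s
  set D := (1 + |t|) * (1 + |s|) with hD
  have hDpos : 0 < D := by positivity
  have hts : 0 ≤ |t| * |s| := by positivity
  have hD1 : 1 + |t| + |s| + |t| * |s| = D := by rw [hD]; ring
  set δ := ρ / (2 * D) with hδ
  have hδpos : 0 < δ := by positivity
  have hδD : δ * D = ρ / 2 := by rw [hδ]; field_simp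
  have hδρ : δ ≤ ρ := by nlinarith
  have hint : ∀ a, 0 ≤ a → a ≤ 1 →
      IntervalIntegrable (fun r => hker r t s) MeasureTheory.volume 0 a := by
    intro a h0 h1
    apply (hker_intervalIntegrable_one t s).mono_set
    rw [Set.uIcc_of_le h0, Set.uIcc_of_le zero_le_one]
    exact Set.Icc_subset_Icc_right h1
  have hA : (∫ r in (0 : ℝ)..δ, hker r t s) ≤ ∫ r in (0 : ℝ)..ρ, hker r t s := by
    apply intervalIntegral.integral_mono_interval le_rfl hδpos.le hδρ
    · exact Filter.Eventually.of_forall fun r => hker_nonneg r t s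
    · exact hint ρ hρ.le hρ1
  have hB : (∫ _ in (0 : ℝ)..δ, Real.exp (-1)) ≤ ∫ r in (0 : ℝ)..δ, hker r t s := by
    apply intervalIntegral.integral_mono_on hδpos.le (by simp)
      (hint δ hδpos.le (hδρ.trans hρ1))
    rintro r ⟨h0, hr⟩
    have hrD : r * D ≤ 1 / 2 := by nlinarith
    rw [← hD1] at hrD
    have e1 : 0 ≤ r * |t| := by positivity
    have e2 : 0 ≤ r * |s| := by positivity
    have e3 : 0 ≤ r * (|t| * |s|) := by positivity
    have hr2 : r ≤ 1 / 2 := by nlinarith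
    have ht2 : r * |t| ≤ 1 / 2 := by nlinarith
    have hs2 : r * |s| ≤ 1 / 2 := by nlinarith
    have hts2 : r * (|t| * |s|) ≤ 1 / 2 := by nlinarith
    have k1 : r ^ 2 ≤ 1 / 4 := by nlinarith
    have k2 : r ^ 2 * t ^ 2 ≤ 1 / 4 := by rw [← sq_abs t]; nlinarith
    have k3 : r ^ 2 * s ^ 2 ≤ 1 / 4 := by rw [← sq_abs s]; nlinarith
    have k4 : -(1 / 2) ≤ r * t * s := by
      rw [← abs_mul] at hts2
      nlinarith [neg_abs_le (t * s)]
    have hpos : 0 < 1 - r ^ 2 := by linarith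
    have f1 : 1 ≤ 1 / Real.sqrt (1 - r ^ 2) := by
      rw [le_div_iff₀ (Real.sqrt_pos.mpr hpos), one_mul, Real.sqrt_le_one]
      nlinarith
    have f2 : Real.exp (-1) ≤
        Real.exp ((r * t * s - (t ^ 2 + s ^ 2) / 2 * r ^ 2) / (1 - r ^ 2)) := by
      apply Real.exp_le_exp.mpr
      rw [le_div_iff₀ hpos]
      nlinarith
    unfold hker
    calc Real.exp (-1) = 1 * Real.exp (-1) := (one_mul _).symm
      _ ≤ _ := by gcongr
  rw [intervalIntegral.integral_const, smul_eq_mul] at hB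
  have : 2 * Real.exp (-1) / 4 * ρ / D = (δ - 0) * Real.exp (-1) := by
    rw [hδ]; field_simp; ring
  rw [ge_iff_le, this]
  exact hB.trans hA
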